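/- Assume there is no strict ε-arbitrage and fix t ∈ {1,…,T}. Then there exists H̄_t ∈ E_{ε,t} with |H̄_t|_p ∈ {0,1} P-a.s. such that H̄_t* ∈ F_{ε,t} and: if p > 1, P[H̄_t ≠ 0] = sup{P[H_t ≠ 0] : H_t ∈ E_{ε,t}}; if p = 1, P[H̄_{t,i} ≠ 0] = sup{P[H_{t,i} ≠ 0] : H_t ∈ E_{ε,t}} for every coordinate i = 1,…,d. Moreover, when p > 1: E_{ε,t} = {a·H̄_t : a an 𝓕_{t-1}-measurable real random variable with a ≥ 0 P-a.s.} (as sets of random vectors up to P-a.s. equality), and the set {H_t ∈ 𝓗_t : X_t·H_t = 0 P-a.s. for every X_t ∈ F_{ε,t}} equals {H_t ∈ 𝓗_t : H_t·H̄_t* = 0 P-a.s. and H_t = 0 P-a.s. on the event {H̄_t = 0}}. -/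

import Mathlib

open MeasureTheory Filter
open scoped ENNReal NNReal

noncomputable section

namespace QFTAP

/-- The `p`-norm on `ℝ^d`. -/
def pNorm {d : ℕ} (p : ℝ) (x : Fin d → ℝ) : ℝ := (∑ i, |x i| ^ p) ^ (1 / p)

/-- The norm dual to the `p`-norm, i.e. the `q`-norm where `1/p + 1/q = 1`
(`q = ∞` when `p = 1`, and `q = p/(p-1)` when `p > 1`). -/
def qNorm {d : ℕ} (p : ℝ) (x : Fin d → ℝ) : ℝ :=
  if p = 1 then ⨆ i, |x i| else pNorm (p / (p - 1)) x

/-- Euclidean scalar product on `ℝ^d`. -/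
def dot {d : ℕ} (x y : Fin d → ℝ) : ℝ := ∑ i, x i * y i

/-- The dual vector `x*` (with the convention `0* = 0`): `x*_i = sgn(x_i) |x_i|^{p-1} / |x|_p^{p-1}`. -/
def dualVec {d : ℕ} (p : ℝ) (x : Fin d → ℝ) : Fin d → ℝ :=
  fun i => Real.sign (x i) * |x i| ^ (p - 1) / (pNorm p x) ^ (p - 1)

variable {Ω : Type*} [mΩ : MeasurableSpace Ω] {d : ℕ}

/-- A trading strategy: `H t` is `ℱ (t-1)`-measurable for every `t ≥ 1`. -/
def IsStrategy (ℱ : Filtration ℕ mΩ) (H : ℕ → Ω → Fin d → ℝ) : Prop :=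
  ∀ t : ℕ, 1 ≤ t → StronglyMeasurable[ℱ (t - 1)] (H t)

/-- The terminal gain `(H • S)_T = ∑_{t=1}^T H_t · ΔS_t`. -/
def gain (S H : ℕ → Ω → Fin d → ℝ) (T : ℕ) (ω : Ω) : ℝ :=
  ∑ t ∈ Finset.Icc 1 T, dot (H t ω) (S t ω - S (t - 1) ω)

/-- `‖H‖_p = ∑_{t=1}^T |H_t|_p`. -/
def stratNorm (p : ℝ) (H : ℕ → Ω → Fin d → ℝ) (T : ℕ) (ω : Ω) : ℝ :=
  ∑ t ∈ Finset.Icc 1 T, pNorm p (H t ω)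

/-- `H` is a strict `ε`-arbitrage. -/
def IsStrictArb (P : Measure Ω) (ℱ : Filtration ℕ mΩ) (S : ℕ → Ω → Fin d → ℝ) (T : ℕ)
    (p ε : ℝ) (H : ℕ → Ω → Fin d → ℝ) : Prop :=
  IsStrategy ℱ H ∧
    (∀ᵐ ω ∂P, 0 ≤ gain S H T ω - ε * stratNorm p H T ω) ∧
    0 < P {ω | 0 < gain S H T ω - ε * stratNorm p H T ω}

/-- A sequence of trading strategies is an `ε`-arbitrage. -/
def IsArb (P : Measure Ω) (ℱ : Filtration ℕ mΩ) (S : ℕ → Ω → Fin d → ℝ) (T : ℕ)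
    (p ε : ℝ) (H : ℕ → ℕ → Ω → Fin d → ℝ) : Prop :=
  (∀ k, IsStrategy ℱ (H k)) ∧
    (∀ᵐ ω ∂P, 0 ≤ atTop.liminf fun k => gain S (H k) T ω - ε * stratNorm p (H k) T ω) ∧
    0 < P {ω | 0 < atTop.liminf fun k => gain S (H k) T ω - ε * stratNorm p (H k) T ω}

/-- The market satisfies `NA_ε`: there is no `ε`-arbitrage. -/
def NA (P : Measure Ω) (ℱ : Filtration ℕ mΩ) (S : ℕ → Ω → Fin d → ℝ) (T : ℕ) (p ε : ℝ) : Prop :=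
  ¬ ∃ H, IsArb P ℱ S T p ε H

/-- The critical value `ε(P) = inf {ε > 0 : no strict ε-arbitrage}`, with `inf ∅ = ∞`. -/
def criticalValue (P : Measure Ω) (ℱ : Filtration ℕ mΩ) (S : ℕ → Ω → Fin d → ℝ) (T : ℕ)
    (p : ℝ) : ℝ≥0∞ :=
  sInf {x : ℝ≥0∞ | ∃ ε : ℝ, 0 < ε ∧ (¬ ∃ H, IsStrictArb P ℱ S T p ε H) ∧ x = ENNReal.ofReal ε}

/-- `Q` is an `ε`-martingale measure: `Q` is a probability measure equivalent to `P`,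
`S_T ∈ L¹(Q)` and `|E_Q[S_t | ℱ_{t-1}] - S_{t-1}|_q ≤ ε` a.s. for all `t = 1,…,T`. -/
def IsEpsMartMeasure (P : Measure Ω) (ℱ : Filtration ℕ mΩ) (S : ℕ → Ω → Fin d → ℝ) (T : ℕ)
    (p ε : ℝ) (Q : Measure Ω) : Prop :=
  IsProbabilityMeasure Q ∧ Q ≪ P ∧ P ≪ Q ∧ Integrable (S T) Q ∧
    ∀ t : ℕ, 1 ≤ t → t ≤ T →
      ∀ᵐ ω ∂Q, qNorm p ((Q[S t | ℱ (t - 1)]) ω - S (t - 1) ω) ≤ ε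

/-- `𝓜_ε(P)`: the `ε`-martingale measures with `P`-essentially bounded density `dQ/dP`. -/
def Meps (P : Measure Ω) (ℱ : Filtration ℕ mΩ) (S : ℕ → Ω → Fin d → ℝ) (T : ℕ)
    (p ε : ℝ) : Set (Measure Ω) :=
  {Q | IsEpsMartMeasure P ℱ S T p ε Q ∧ ∃ C : ℝ≥0, ∀ᵐ ω ∂P, Q.rnDeriv P ω ≤ C}

/-- `K = {(H•S)_T - ε ‖H‖_p : H ∈ 𝓗}`. -/
def Kset (ℱ : Filtration ℕ mΩ) (S : ℕ → Ω → Fin d → ℝ) (T : ℕ) (p ε : ℝ) : Set (Ω → ℝ) :=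
  {X | ∃ H, IsStrategy ℱ H ∧ X = fun ω => gain S H T ω - ε * stratNorm p H T ω}

/-- `K̄`: the closure of `K` with respect to convergence in `P`-probability. -/
def Kbar (P : Measure Ω) (ℱ : Filtration ℕ mΩ) (S : ℕ → Ω → Fin d → ℝ) (T : ℕ)
    (p ε : ℝ) : Set (Ω → ℝ) :=
  {X | ∃ Y : ℕ → Ω → ℝ, (∀ n, Y n ∈ Kset ℱ S T p ε) ∧ TendstoInMeasure P Y atTop X}

/-- `C = {X : ∃ Y ∈ K̄, X ≤ Y a.s.}`. -/
def Cset (P : Measure Ω) (ℱ : Filtration ℕ mΩ) (S : ℕ → Ω → Fin d → ℝ) (T : ℕ)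
    (p ε : ℝ) : Set (Ω → ℝ) :=
  {X | ∃ Y ∈ Kbar P ℱ S T p ε, ∀ᵐ ω ∂P, X ω ≤ Y ω}

/-- `E_{ε,t} = {H_t ∈ 𝓗_t : H_t · ΔS_t = ε |H_t|_p a.s.}`. -/
def Eset (P : Measure Ω) (ℱ : Filtration ℕ mΩ) (S : ℕ → Ω → Fin d → ℝ)
    (p ε : ℝ) (t : ℕ) : Set (Ω → Fin d → ℝ) :=
  {h | StronglyMeasurable[ℱ (t - 1)] h ∧
    ∀ᵐ ω ∂P, dot (h ω) (S t ω - S (t - 1) ω) = ε * pNorm p (h ω)}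

/-- `E_{0,t} = {H_t ∈ 𝓗_t : H_t · ΔS_t = 0 a.s.}`. -/
def E0set (P : Measure Ω) (ℱ : Filtration ℕ mΩ) (S : ℕ → Ω → Fin d → ℝ)
    (t : ℕ) : Set (Ω → Fin d → ℝ) :=
  {h | StronglyMeasurable[ℱ (t - 1)] h ∧
    ∀ᵐ ω ∂P, dot (h ω) (S t ω - S (t - 1) ω) = 0}

/-- `E_{0,t}^⊥`. -/
def E0perp (P : Measure Ω) (ℱ : Filtration ℕ mΩ) (S : ℕ → Ω → Fin d → ℝ)
    (t : ℕ) : Set (Ω → Fin d → ℝ) :=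
  {h | StronglyMeasurable[ℱ (t - 1)] h ∧
    ∀ g ∈ E0set P ℱ S t, ∀ᵐ ω ∂P, dot (h ω) (g ω) = 0}

/-- `F_{ε,t} = {X_t ∈ 𝓗_t : X_t · H_t = |X_t|_q |H_t|_p a.s. for every H_t ∈ E_{ε,t}}`. -/
def Fset (P : Measure Ω) (ℱ : Filtration ℕ mΩ) (S : ℕ → Ω → Fin d → ℝ)
    (p ε : ℝ) (t : ℕ) : Set (Ω → Fin d → ℝ) :=
  {X | StronglyMeasurable[ℱ (t - 1)] X ∧
    ∀ h ∈ Eset P ℱ S p ε t, ∀ᵐ ω ∂P, dot (X ω) (h ω) = qNorm p (X ω) * pNorm p (h ω)}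

/-- `F_{ε,t}^⊥`, depending on a fixed maximal element `H̄_t` of `E_{ε,t}` when `p = 1`. -/
def Fperp (P : Measure Ω) (ℱ : Filtration ℕ mΩ) (S : ℕ → Ω → Fin d → ℝ)
    (p ε : ℝ) (t : ℕ) (Hb : Ω → Fin d → ℝ) : Set (Ω → Fin d → ℝ) :=
  if p = 1 then
    {h | StronglyMeasurable[ℱ (t - 1)] h ∧
      (∀ᵐ ω ∂P, dot (dualVec 1 (Hb ω)) (h ω) = 0) ∧
      ∀ i, ∀ᵐ ω ∂P, Hb ω i = 0 → h ω i = 0}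
  else
    {h | StronglyMeasurable[ℱ (t - 1)] h ∧
      ∀ X ∈ Fset P ℱ S p ε t, ∀ᵐ ω ∂P, dot (X ω) (h ω) = 0}

/-- `𝓗̄_t`: strategies supported on the support of `H̄_t` (componentwise when `p = 1`). -/
def HbarSpace (P : Measure Ω) (ℱ : Filtration ℕ mΩ) (p : ℝ) (t : ℕ)
    (Hb : Ω → Fin d → ℝ) : Set (Ω → Fin d → ℝ) :=
  if p = 1 then
    {h | StronglyMeasurable[ℱ (t - 1)] h ∧ ∀ i, ∀ᵐ ω ∂P, Hb ω i = 0 → h ω i = 0}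
  else
    {h | StronglyMeasurable[ℱ (t - 1)] h ∧ ∀ᵐ ω ∂P, Hb ω = 0 → h ω = 0}

/-- The defining properties of `H̄_t`: an element of `E_{ε,t}` with `|H̄_t|_p ∈ {0,1}` a.s. of
maximal support (componentwise maximal when `p = 1`). -/
def IsMaximalEps (P : Measure Ω) (ℱ : Filtration ℕ mΩ) (S : ℕ → Ω → Fin d → ℝ)
    (p ε : ℝ) (t : ℕ) (Hb : Ω → Fin d → ℝ) : Prop :=
  Hb ∈ Eset P ℱ S p ε t ∧
    (∀ᵐ ω ∂P, pNorm p (Hb ω) = 0 ∨ pNorm p (Hb ω) = 1) ∧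
    (1 < p → P {ω | Hb ω ≠ 0} = ⨆ h ∈ Eset P ℱ S p ε t, P {ω | h ω ≠ 0}) ∧
    (p = 1 → ∀ i, P {ω | Hb ω i ≠ 0} = ⨆ h ∈ Eset P ℱ S p ε t, P {ω | h ω i ≠ 0})

/-- `F_ε^⊥ = {G ∈ 𝓗 : G_t ∈ F_{ε,t}^⊥ for every t = 1,…,T}`. -/
def FperpStrat (P : Measure Ω) (ℱ : Filtration ℕ mΩ) (S : ℕ → Ω → Fin d → ℝ) (T : ℕ)
    (p ε : ℝ) (Hb : ℕ → Ω → Fin d → ℝ) : Set (ℕ → Ω → Fin d → ℝ) :=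
  {G | ∀ t, 1 ≤ t → t ≤ T → G t ∈ Fperp P ℱ S p ε t (Hb t)}

/-- The market satisfies `NA'_ε`. -/
def NAprime (P : Measure Ω) (ℱ : Filtration ℕ mΩ) (S : ℕ → Ω → Fin d → ℝ) (T : ℕ)
    (p ε : ℝ) (Hb : ℕ → Ω → Fin d → ℝ) : Prop :=
  (¬ ∃ H, IsStrictArb P ℱ S T p ε H) ∧
    ∀ G ∈ FperpStrat P ℱ S T p ε Hb,
      (∀ᵐ ω ∂P, 0 ≤ gain S G T ω) → ∀ᵐ ω ∂P, gain S G T ω = 0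

/-- `ψ` is an `ε`-fair price for `Ψ`. -/
def IsFairPrice (P : Measure Ω) (ℱ : Filtration ℕ mΩ) (S : ℕ → Ω → Fin d → ℝ) (T : ℕ)
    (p ε : ℝ) (Ψ : Ω → ℝ) (ψ : ℝ) : Prop :=
  ∀ (H : ℕ → ℕ → Ω → Fin d → ℝ) (a : ℕ → ℝ), (∀ k, IsStrategy ℱ (H k)) →
    (∀ᵐ ω ∂P, 0 ≤ atTop.liminf fun k =>
      gain S (H k) T ω + a k * (Ψ ω - ψ) - ε * (stratNorm p (H k) T ω + |a k|)) →
    ∀ᵐ ω ∂P, atTop.liminf (fun k =>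
      gain S (H k) T ω + a k * (Ψ ω - ψ) - ε * (stratNorm p (H k) T ω + |a k|)) = 0

section Pointwise

lemma dot_comm (x y : Fin d → ℝ) : dot x y = dot y x := by
  simp only [dot, mul_comm]

lemma dot_add_left (x y z : Fin d → ℝ) : dot (x + y) z = dot x z + dot y z := by
  simp [dot, add_mul, Finset.sum_add_distrib]

lemma dot_smul_left (a : ℝ) (x y : Fin d → ℝ) : dot (a • x) y = a * dot x y := by
  simp [dot, mul_assoc, Finset.mul_sum]

lemma dot_self_eq_zero {x : Fin d → ℝ} (h : dot x x = 0) : x = 0 := by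
  rw [dot, Finset.sum_eq_zero_iff_of_nonneg fun i _ => mul_self_nonneg (x i)] at h
  ext i
  simpa using h i (Finset.mem_univ i)

@[simp]
lemma dot_zero_left (x : Fin d → ℝ) : dot 0 x = 0 := by simp [dot]

@[simp]
lemma dot_zero_right (x : Fin d → ℝ) : dot x 0 = 0 := by simp [dot]

lemma continuous_dot : Continuous fun z : (Fin d → ℝ) × (Fin d → ℝ) => dot z.1 z.2 := by
  unfold dot
  fun_prop

lemma pNorm_eq_norm {p : ℝ} (hp : 1 ≤ p) (x : Fin d → ℝ) :
    pNorm p x = ‖WithLp.toLp (ENNReal.ofReal p) x‖ := by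
  have h : (ENNReal.ofReal p).toReal = p := ENNReal.toReal_ofReal (by linarith)
  rw [PiLp.norm_eq_sum (by rw [h]; linarith), h]
  simp [pNorm]

lemma pNorm_nonneg (p : ℝ) (x : Fin d → ℝ) : 0 ≤ pNorm p x := by
  unfold pNorm
  positivity

lemma pNorm_add_le {p : ℝ} (hp : 1 ≤ p) (x y : Fin d → ℝ) :
    pNorm p (x + y) ≤ pNorm p x + pNorm p y := by
  have : Fact (1 ≤ ENNReal.ofReal p) := ⟨by simpa using hp⟩
  simpa only [pNorm_eq_norm hp, WithLp.toLp_add] using norm_add_le _ _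

lemma pNorm_smul {p : ℝ} (hp : 1 ≤ p) (a : ℝ) (x : Fin d → ℝ) :
    pNorm p (a • x) = |a| * pNorm p x := by
  have : Fact (1 ≤ ENNReal.ofReal p) := ⟨by simpa using hp⟩
  simpa only [pNorm_eq_norm hp, WithLp.toLp_smul, Real.norm_eq_abs] using
    norm_smul a (WithLp.toLp (ENNReal.ofReal p) x)

lemma pNorm_eq_zero {p : ℝ} (hp : 1 ≤ p) {x : Fin d → ℝ} : pNorm p x = 0 ↔ x = 0 := by
  have : Fact (1 ≤ ENNReal.ofReal p) := ⟨by simpa using hp⟩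
  rw [pNorm_eq_norm hp, norm_eq_zero, WithLp.toLp_eq_zero]

@[simp]
lemma pNorm_one (x : Fin d → ℝ) : pNorm 1 x = ∑ i, |x i| := by simp [pNorm]

lemma pNorm_rpow {p : ℝ} (hp : 1 ≤ p) (x : Fin d → ℝ) : pNorm p x ^ p = ∑ i, |x i| ^ p := by
  rw [pNorm, one_div, Real.rpow_inv_rpow (by positivity) (by linarith)]

lemma measurable_pNorm (p : ℝ) : Measurable (pNorm p : (Fin d → ℝ) → ℝ) := by
  unfold pNorm
  fun_prop

lemma measurable_sign : Measurable Real.sign := by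
  unfold Real.sign
  exact Measurable.ite measurableSet_Iio measurable_const
    (Measurable.ite measurableSet_Ioi measurable_const measurable_const)

lemma measurable_dualVec (p : ℝ) : Measurable (dualVec p : (Fin d → ℝ) → Fin d → ℝ) := by
  refine measurable_pi_lambda _ fun i => ?_
  unfold dualVec
  have := measurable_sign
  have := measurable_pNorm (d := d) p
  fun_prop

@[simp]
lemma dualVec_zero (p : ℝ) : dualVec p (0 : Fin d → ℝ) = 0 := by
  ext i
  simp [dualVec]

lemma sign_mul_self_eq_abs (r : ℝ) : Real.sign r * r = |r| := by
  rcases lt_trichotomy r 0 with h | rfl | h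
  · rw [Real.sign_of_neg h, abs_of_neg h]; ring
  · simp
  · rw [Real.sign_of_pos h, abs_of_pos h]; ring

lemma abs_sign_of_ne_zero {r : ℝ} (hr : r ≠ 0) : |Real.sign r| = 1 := by
  rcases Real.sign_apply_eq_of_ne_zero r hr with h | h <;> simp [h]

lemma qNorm_of_holderConjugate {p q : ℝ} (hpq : p.HolderConjugate q) (x : Fin d → ℝ) :
    qNorm p x = pNorm q x := by
  rw [qNorm, if_neg hpq.lt.ne', hpq.conjugate_eq]

lemma dot_le_pNorm_mul_pNorm {p q : ℝ} (hpq : p.HolderConjugate q) (x y : Fin d → ℝ) :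
    dot x y ≤ pNorm p x * pNorm q y :=
  Real.inner_le_Lp_mul_Lq _ _ _ hpq

lemma dot_dualVec_of_pNorm_eq_one {p : ℝ} (hp : 1 < p) {x : Fin d → ℝ} (hx : pNorm p x = 1) :
    dot (dualVec p x) x = 1 := by
  have h := pNorm_rpow hp.le x
  rw [hx, Real.one_rpow] at h
  rw [h, dot]
  refine Finset.sum_congr rfl fun i _ => ?_
  rw [dualVec, hx, Real.one_rpow, div_one, mul_right_comm, sign_mul_self_eq_abs]
  rcases (abs_nonneg (x i)).eq_or_lt with h0 | h0
  · rw [← h0, zero_mul, Real.zero_rpow (by linarith)]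
  · nth_rw 1 [← Real.rpow_one |x i|]
    rw [← Real.rpow_add h0]
    congr 1
    ring

lemma pNorm_dualVec_of_pNorm_eq_one {p q : ℝ} (hpq : p.HolderConjugate q) {x : Fin d → ℝ}
    (hx : pNorm p x = 1) : pNorm q (dualVec p x) = 1 := by
  have h := pNorm_rpow hpq.lt.le x
  rw [hx, Real.one_rpow] at h
  have h2 : ∑ i, |dualVec p x i| ^ q = ∑ i, |x i| ^ p := by
    refine Finset.sum_congr rfl fun i _ => ?_
    rw [dualVec, hx, Real.one_rpow, div_one, abs_mul,
      abs_of_nonneg (Real.rpow_nonneg (abs_nonneg (x i)) (p - 1))]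
    by_cases h0 : x i = 0
    · simp [h0, Real.zero_rpow hpq.ne_zero, Real.zero_rpow hpq.symm.ne_zero]
    · rw [abs_sign_of_ne_zero h0, one_mul, ← Real.rpow_mul (abs_nonneg _), hpq.sub_one_mul_conj]
  rw [pNorm, h2, ← h, Real.one_rpow]

/-- The equality case of Hölder's inequality. -/
lemma eq_dualVec_of_dot_eq_one {p q : ℝ} (hpq : p.HolderConjugate q) {x y : Fin d → ℝ}
    (hx : pNorm p x = 1) (hy : pNorm q y = 1) (h : dot x y = 1) : y = dualVec p x := by
  have hxs := pNorm_rpow hpq.lt.le x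
  have hys := pNorm_rpow hpq.symm.lt.le y
  rw [hx, Real.one_rpow] at hxs
  rw [hy, Real.one_rpow] at hys
  have hsum : ∑ i, x i * y i = ∑ i, (|x i| ^ p / p + |y i| ^ q / q) := by
    rw [Finset.sum_add_distrib, ← Finset.sum_div, ← Finset.sum_div, ← hxs, ← hys]
    simpa [hpq.inv_add_inv_eq_one, dot] using h
  rw [Finset.sum_eq_sum_iff_of_le fun i _ => Real.young_inequality (x i) (y i) hpq] at hsum
  ext i
  have hi := hsum i (Finset.mem_univ i)
  have h1 := Real.young_inequality_of_nonneg (abs_nonneg (x i)) (abs_nonneg (y i)) hpq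
  have h2 : |x i| * |y i| = |x i| ^ p / p + |y i| ^ q / q :=
    le_antisymm h1 (hi ▸ (le_abs_self _).trans (abs_mul _ _).le)
  have h3 := (Real.young_inequality_eq_iff_of_nonneg (abs_nonneg _) (abs_nonneg _) hpq).1 h2
  have habs : |y i| = |x i| ^ (p - 1) := by
    rw [← Real.rpow_left_inj (abs_nonneg _) (by positivity) hpq.symm.ne_zero, ← h3,
      ← Real.rpow_mul (abs_nonneg _), hpq.sub_one_mul_conj]
  rw [dualVec, hx, Real.one_rpow, div_one, ← habs]
  have h4 : x i * y i = |x i| * |y i| := hi.trans h2.symm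
  rcases lt_trichotomy (x i) 0 with h0 | h0 | h0
  · rw [Real.sign_of_neg h0]
    rw [abs_of_neg h0] at h4
    have : x i * (y i + |y i|) = 0 := by linarith
    rcases mul_eq_zero.1 this with h5 | h5 <;> linarith
  · rw [h0] at habs ⊢
    rw [abs_zero, Real.zero_rpow hpq.sub_one_ne_zero, abs_eq_zero] at habs
    simp [habs]
  · rw [Real.sign_of_pos h0, one_mul]
    rw [abs_of_pos h0] at h4
    exact mul_left_cancel₀ h0.ne' h4

lemma pNorm_inv_smul_self {p : ℝ} (hp : 1 ≤ p) {x : Fin d → ℝ} (hx : x ≠ 0) :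
    pNorm p ((pNorm p x)⁻¹ • x) = 1 := by
  rw [pNorm_smul hp, abs_inv, abs_of_nonneg (pNorm_nonneg p x),
    inv_mul_cancel₀ ((pNorm_eq_zero hp).not.2 hx)]

/-- The `p`-norm is strictly convex for `p > 1`. -/
lemma pNorm_smul_eq_of_pNorm_add_eq {p : ℝ} (hp : 1 < p) {x y : Fin d → ℝ}
    (h : pNorm p (x + y) = pNorm p x + pNorm p y) : pNorm p y • x = pNorm p x • y := by
  by_cases hx : x = 0
  · simp [hx, (pNorm_eq_zero hp.le).2]
  by_cases hy : y = 0
  · simp [hy, (pNorm_eq_zero hp.le).2]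
  have hpq := Real.HolderConjugate.conjExponent hp
  have hx' : 0 < pNorm p x := (pNorm_nonneg p x).lt_of_ne' ((pNorm_eq_zero hp.le).not.2 hx)
  have hy' : 0 < pNorm p y := (pNorm_nonneg p y).lt_of_ne' ((pNorm_eq_zero hp.le).not.2 hy)
  have hxy : x + y ≠ 0 := fun h0 => by
    rw [h0, (pNorm_eq_zero hp.le).2 rfl] at h
    linarith
  set u := (pNorm p (x + y))⁻¹ • (x + y) with hu
  have hu1 : pNorm p u = 1 := pNorm_inv_smul_self hp.le hxy
  set z := dualVec p u
  have hz : pNorm p.conjExponent z = 1 := pNorm_dualVec_of_pNorm_eq_one hpq hu1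
  have hzu : dot u z = 1 := by rw [dot_comm]; exact dot_dualVec_of_pNorm_eq_one hp hu1
  rw [hu, dot_smul_left, dot_add_left, h, inv_mul_eq_one₀ (by linarith)] at hzu
  have hxz := dot_le_pNorm_mul_pNorm hpq x z
  have hyz := dot_le_pNorm_mul_pNorm hpq y z
  rw [hz, mul_one] at hxz hyz
  have key : ∀ w : Fin d → ℝ, w ≠ 0 → dot w z = pNorm p w →
      (pNorm p w)⁻¹ • w = dualVec p.conjExponent z := fun w hw hwz =>
    eq_dualVec_of_dot_eq_one hpq.symm hz (pNorm_inv_smul_self hp.le hw) <| by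
      rw [dot_comm, dot_smul_left, hwz, inv_mul_cancel₀ ((pNorm_eq_zero hp.le).not.2 hw)]
  have h1 := (key x hx (by linarith)).trans (key y hy (by linarith)).symm
  calc pNorm p y • x = (pNorm p y * pNorm p x) • (pNorm p x)⁻¹ • x := by
        rw [smul_smul, mul_assoc, mul_inv_cancel₀ hx'.ne', mul_one]
    _ = pNorm p x • y := by
        rw [h1, smul_smul, mul_comm, mul_comm (pNorm p y), ← mul_assoc,
          mul_comm _ (pNorm p x), mul_assoc, inv_mul_cancel₀ hy'.ne', mul_one]

lemma mul_nonneg_of_pNorm_add_eq {p : ℝ} (hp : 1 ≤ p) {x y : Fin d → ℝ}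
    (h : pNorm p (x + y) = pNorm p x + pNorm p y) (i : Fin d) : 0 ≤ x i * y i := by
  rcases hp.eq_or_lt with rfl | hp
  · simp only [pNorm_one, ← Finset.sum_add_distrib, Pi.add_apply] at h
    rw [Finset.sum_eq_sum_iff_of_le fun i _ => abs_add_le (x i) (y i)] at h
    rcases abs_add_eq_add_abs_iff _ _ |>.1 (h i (Finset.mem_univ i)) with h | h
    · exact mul_nonneg h.1 h.2
    · exact mul_nonneg_of_nonpos_of_nonpos h.1 h.2
  · by_cases hy : y = 0
    · simp [hy]
    have hy' : 0 < pNorm p y := (pNorm_nonneg p y).lt_of_ne' ((pNorm_eq_zero hp.le).not.2 hy)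
    have hi := congrFun (pNorm_smul_eq_of_pNorm_add_eq hp h) i
    simp only [Pi.smul_apply, smul_eq_mul] at hi
    refine nonneg_of_mul_nonneg_right ?_ hy'
    rw [← mul_assoc, hi, mul_assoc]
    exact mul_nonneg (pNorm_nonneg p x) (mul_self_nonneg _)

end Pointwise

section Measurability

variable {α : Type*} {m : MeasurableSpace α}

lemma stronglyMeasurable_pNorm (p : ℝ) {h : α → Fin d → ℝ} (hh : StronglyMeasurable[m] h) :
    StronglyMeasurable[m] fun ω => pNorm p (h ω) :=
  ((measurable_pNorm p).comp hh.measurable).stronglyMeasurable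

lemma stronglyMeasurable_dualVec (p : ℝ) {h : α → Fin d → ℝ} (hh : StronglyMeasurable[m] h) :
    StronglyMeasurable[m] fun ω => dualVec p (h ω) :=
  ((measurable_dualVec p).comp hh.measurable).stronglyMeasurable

lemma measurableSet_apply_ne_zero {h : α → Fin d → ℝ} (hh : StronglyMeasurable[m] h)
    (i : Fin d) : MeasurableSet[m] {ω | h ω i ≠ 0} :=
  ((measurable_pi_apply i).comp hh.measurable) (measurableSet_singleton (0 : ℝ)).compl

end Measurability

section Eset

variable {P : Measure Ω} {ℱ : Filtration ℕ mΩ} {S : ℕ → Ω → Fin d → ℝ} {T t : ℕ} {p ε : ℝ}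

/-- Without strict `ε`-arbitrage, a one-period position whose gain covers its cost lies in
`E_{ε,t}`. -/
lemma mem_Eset_of_ae_le (hp : 1 ≤ p) (hNSA : ¬ ∃ H, IsStrictArb P ℱ S T p ε H)
    (ht1 : 1 ≤ t) (htT : t ≤ T) {h : Ω → Fin d → ℝ} (hh : StronglyMeasurable[ℱ (t - 1)] h)
    (hle : ∀ᵐ ω ∂P, ε * pNorm p (h ω) ≤ dot (h ω) (S t ω - S (t - 1) ω)) :
    h ∈ Eset P ℱ S p ε t := by
  refine ⟨hh, ?_⟩
  set H : ℕ → Ω → Fin d → ℝ := fun s => if s = t then h else 0 with hH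
  have hstrat : IsStrategy ℱ H := by
    intro s _
    by_cases hs : s = t
    · subst hs
      simpa [hH] using hh
    · simpa [hH, hs] using stronglyMeasurable_zero
  have hmem : t ∈ Finset.Icc 1 T := Finset.mem_Icc.2 ⟨ht1, htT⟩
  have hval : ∀ ω, gain S H T ω - ε * stratNorm p H T ω =
      dot (h ω) (S t ω - S (t - 1) ω) - ε * pNorm p (h ω) := by
    intro ω
    rw [gain, stratNorm, Finset.sum_eq_single_of_mem t hmem, Finset.sum_eq_single_of_mem t hmem]
    · simp [hH]
    · intro s _ hs
      simp [hH, hs, pNorm_eq_zero hp]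
    · intro s _ hs
      simp [hH, hs]
  have hnonneg : ∀ᵐ ω ∂P, 0 ≤ gain S H T ω - ε * stratNorm p H T ω := by
    filter_upwards [hle] with ω hω
    rw [hval]
    linarith
  have hnull : P {ω | 0 < gain S H T ω - ε * stratNorm p H T ω} = 0 := by
    by_contra h0
    exact hNSA ⟨H, hstrat, hnonneg, pos_iff_ne_zero.2 h0⟩
  have hae : ∀ᵐ ω ∂P, ¬ 0 < gain S H T ω - ε * stratNorm p H T ω := by
    rw [ae_iff]
    simpa using hnull
  filter_upwards [hle, hae] with ω h1 h2
  rw [hval] at h2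
  linarith

lemma zero_mem_Eset (hp : 1 ≤ p) : (0 : Ω → Fin d → ℝ) ∈ Eset P ℱ S p ε t :=
  ⟨stronglyMeasurable_zero, by simp [(pNorm_eq_zero hp).2]⟩

lemma add_mem_Eset (hp : 1 ≤ p) (hε : 0 < ε) (hNSA : ¬ ∃ H, IsStrictArb P ℱ S T p ε H)
    (ht1 : 1 ≤ t) (htT : t ≤ T) {h g : Ω → Fin d → ℝ}
    (hh : h ∈ Eset P ℱ S p ε t) (hg : g ∈ Eset P ℱ S p ε t) : h + g ∈ Eset P ℱ S p ε t := by
  refine mem_Eset_of_ae_le hp hNSA ht1 htT (hh.1.add hg.1) ?_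
  filter_upwards [hh.2, hg.2] with ω h1 h2
  rw [Pi.add_apply, dot_add_left, h1, h2, ← mul_add]
  exact mul_le_mul_of_nonneg_left (pNorm_add_le hp _ _) hε.le

/-- Without strict `ε`-arbitrage, the `p`-norm is additive on `E_{ε,t}`. -/
lemma pNorm_add_eq_of_mem_Eset (hp : 1 ≤ p) (hε : 0 < ε)
    (hNSA : ¬ ∃ H, IsStrictArb P ℱ S T p ε H) (ht1 : 1 ≤ t) (htT : t ≤ T)
    {h g : Ω → Fin d → ℝ} (hh : h ∈ Eset P ℱ S p ε t) (hg : g ∈ Eset P ℱ S p ε t) :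
    ∀ᵐ ω ∂P, pNorm p (h ω + g ω) = pNorm p (h ω) + pNorm p (g ω) := by
  filter_upwards [hh.2, hg.2, (add_mem_Eset hp hε hNSA ht1 htT hh hg).2] with ω h1 h2 h3
  rw [Pi.add_apply, dot_add_left, h1, h2, ← mul_add] at h3
  exact (mul_left_cancel₀ hε.ne' h3).symm

lemma smul_mem_Eset (hp : 1 ≤ p) {h : Ω → Fin d → ℝ} (hh : h ∈ Eset P ℱ S p ε t) {a : Ω → ℝ}
    (ha : StronglyMeasurable[ℱ (t - 1)] a) (ha0 : ∀ᵐ ω ∂P, 0 ≤ a ω) :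
    (fun ω => a ω • h ω) ∈ Eset P ℱ S p ε t := by
  refine ⟨ha.smul hh.1, ?_⟩
  filter_upwards [hh.2, ha0] with ω h1 h2
  rw [dot_smul_left, pNorm_smul hp, h1, abs_of_nonneg h2]
  ring

lemma sum_mem_Eset (hp : 1 ≤ p) (hε : 0 < ε) (hNSA : ¬ ∃ H, IsStrictArb P ℱ S T p ε H)
    (ht1 : 1 ≤ t) (htT : t ≤ T) {ι : Type*} (s : Finset ι) {g : ι → Ω → Fin d → ℝ}
    (hg : ∀ j, g j ∈ Eset P ℱ S p ε t) : ∑ j ∈ s, g j ∈ Eset P ℱ S p ε t :=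
  Finset.sum_induction g (· ∈ Eset P ℱ S p ε t)
    (fun _ _ => add_mem_Eset hp hε hNSA ht1 htT) (zero_mem_Eset hp) fun j _ => hg j

/-- Countably many elements of `E_{ε,t}` can be pasted along the events where their `i`-th
coordinates do not vanish. -/
lemma exists_mem_Eset_of_seq (i : Fin d) {h : ℕ → Ω → Fin d → ℝ}
    (hh : ∀ n, h n ∈ Eset P ℱ S p ε t) :
    ∃ g ∈ Eset P ℱ S p ε t, ∀ n ω, h n ω i ≠ 0 → g ω i ≠ 0 := by
  classical
  have hex : ∀ ω, ∃ n, h n ω i ≠ 0 ∨ ∀ k, h k ω i = 0 := by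
    intro ω
    by_cases h0 : ∀ k, h k ω i = 0
    · exact ⟨0, Or.inr h0⟩
    · push Not at h0
      exact h0.imp fun _ => Or.inl
  refine ⟨fun ω => h (Nat.find (hex ω)) ω, ⟨?_, ?_⟩, ?_⟩
  · refine (@Measurable.find _ _ _ (ℱ (t - 1)) _ _ _ (fun n => (hh n).1.measurable) (fun n => ?_)
      hex).stronglyMeasurable
    refine (measurableSet_apply_ne_zero (hh n).1 i).union ?_
    have : {ω | ∀ k, h k ω i = 0} = ⋂ k, {ω | h k ω i ≠ 0}ᶜ := by
      ext ω
      simp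
    change MeasurableSet[ℱ (t - 1)] {ω | ∀ k, h k ω i = 0}
    rw [this]
    exact MeasurableSet.iInter fun k => (measurableSet_apply_ne_zero (hh k).1 i).compl
  · filter_upwards [ae_all_iff.2 fun n => (hh n).2] with ω hω using hω _
  · intro n ω hn
    exact (Nat.find_spec (hex ω)).resolve_right fun h0 => hn (h0 n)

/-- Some element of `E_{ε,t}` has an essentially maximal support in the `i`-th coordinate. -/
lemma exists_mem_Eset_maximal_apply [IsFiniteMeasure P] (hp : 1 ≤ p) (i : Fin d) :
    ∃ g ∈ Eset P ℱ S p ε t, ∀ h ∈ Eset P ℱ S p ε t, ∀ᵐ ω ∂P, h ω i ≠ 0 → g ω i ≠ 0 := by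
  set A : Set ℝ≥0∞ := (fun h : Ω → Fin d → ℝ => P {ω | h ω i ≠ 0}) '' Eset P ℱ S p ε t
  obtain ⟨u, -, hu, huA⟩ := exists_seq_tendsto_sSup (S := A)
    (Set.Nonempty.image _ ⟨0, zero_mem_Eset hp⟩) (OrderTop.bddAbove A)
  choose h hh hhu using huA
  obtain ⟨g, hg, hgh⟩ := exists_mem_Eset_of_seq i hh
  have hsup : sSup A ≤ P {ω | g ω i ≠ 0} :=
    le_of_tendsto' hu fun n => hhu n ▸ measure_mono fun ω => hgh n ω
  refine ⟨g, hg, fun k hk => ?_⟩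
  obtain ⟨f, hf, hfgk⟩ := exists_mem_Eset_of_seq i (h := fun n => if n = 0 then g else k)
    fun n => by split_ifs <;> assumption
  have hgf : {ω | g ω i ≠ 0} ⊆ {ω | f ω i ≠ 0} := fun ω hω => hfgk 0 ω (by simpa using hω)
  have hmeas := (measurableSet_apply_ne_zero hg.1 i)
  have hae := ae_eq_of_subset_of_measure_ge hgf ((le_sSup (Set.mem_image_of_mem _ hf)).trans hsup)
    (ℱ.le _ _ hmeas).nullMeasurableSet (measure_ne_top P _)
  filter_upwards [hae.mem_iff] with ω hω hkω
  exact hω.2 (hfgk 1 ω (by simpa using hkω))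

/-- Without strict `ε`-arbitrage, some element of `E_{ε,t}` has an essentially maximal support
in every coordinate, and its `p`-norm takes only the values `0` and `1`. -/
lemma exists_mem_Eset_maximal [IsFiniteMeasure P] (hp : 1 ≤ p) (hε : 0 < ε)
    (hNSA : ¬ ∃ H, IsStrictArb P ℱ S T p ε H) (ht1 : 1 ≤ t) (htT : t ≤ T) :
    ∃ g ∈ Eset P ℱ S p ε t, (∀ ω, g ω ≠ 0 → pNorm p (g ω) = 1) ∧
      ∀ h ∈ Eset P ℱ S p ε t, ∀ᵐ ω ∂P, ∀ i, h ω i ≠ 0 → g ω i ≠ 0 := by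
  choose f hf hfmax using exists_mem_Eset_maximal_apply (P := P) (ℱ := ℱ) (S := S) (ε := ε)
    (t := t) (d := d) hp
  set G := ∑ j, f j with hG
  have hGE : G ∈ Eset P ℱ S p ε t := sum_mem_Eset hp hε hNSA ht1 htT _ hf
  have hsign : ∀ᵐ ω ∂P, ∀ j k i, 0 ≤ f j ω i * f k ω i := by
    rw [ae_all_iff]; intro j
    rw [ae_all_iff]; intro k
    filter_upwards [pNorm_add_eq_of_mem_Eset hp hε hNSA ht1 htT (hf j) (hf k)] with ω hω
    exact mul_nonneg_of_pNorm_add_eq hp hω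
  refine ⟨fun ω => (pNorm p (G ω))⁻¹ • G ω,
    smul_mem_Eset hp hGE (stronglyMeasurable_pNorm p hGE.1).measurable.inv.stronglyMeasurable
      (Eventually.of_forall fun ω => inv_nonneg.2 (pNorm_nonneg p _)), fun ω hω => ?_,
    fun h hh => ?_⟩
  · exact pNorm_inv_smul_self hp fun h0 => hω (by simp [h0])
  · filter_upwards [hsign, ae_all_iff.2 fun i => hfmax i h hh] with ω hs hmax i hi
    have hfi := hmax i hi
    have hGi : G ω i ≠ 0 := by
      intro h0
      have hpos : 0 < ∑ j, f i ω i * f j ω i :=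
        Finset.sum_pos' (fun j _ => hs i j i)
          ⟨i, Finset.mem_univ i, mul_self_pos.2 hfi⟩
      rw [← Finset.mul_sum] at hpos
      have : ∑ j, f j ω i = 0 := by simpa [hG] using h0
      simp [this] at hpos
    exact mul_ne_zero (inv_ne_zero ((pNorm_eq_zero hp).not.2 fun h0 => hGi (by simp [h0]))) hGi

end Eset

lemma measure_eq_iSup_of_maximal {P : Measure Ω} {E : Set (Ω → Fin d → ℝ)}
    {g : Ω → Fin d → ℝ} (hg : g ∈ E) (r : (Fin d → ℝ) → Prop)
    (hmax : ∀ h ∈ E, ∀ᵐ ω ∂P, r (h ω) → r (g ω)) :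
    P {ω | r (g ω)} = ⨆ h ∈ E, P {ω | r (h ω)} :=
  le_antisymm (le_iSup₂ (f := fun h (_ : h ∈ E) => P {ω | r (h ω)}) g hg)
    (iSup₂_le fun h hh => measure_mono_ae (hmax h hh))

/-- If `y` agrees in sign with `x` and is supported on the support of `x`, then `x*` attains the
dual `1`-norm at `y`. -/
lemma dot_dualVec_one {x y : Fin d → ℝ} (hxy : ∀ i, 0 ≤ x i * y i)
    (hsupp : ∀ i, y i ≠ 0 → x i ≠ 0) :
    dot (dualVec 1 x) y = qNorm 1 (dualVec 1 x) * pNorm 1 y := by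
  have hdual : ∀ i, dualVec 1 x i = Real.sign (x i) := fun i => by simp [dualVec]
  have hdot : dot (dualVec 1 x) y = pNorm 1 y := by
    rw [pNorm_one, dot]
    refine Finset.sum_congr rfl fun i _ => ?_
    rw [hdual]
    by_cases hy : y i = 0
    · simp [hy]
    rcases (hsupp i hy).lt_or_gt with hx | hx
    · rw [Real.sign_of_neg hx, abs_of_nonpos (nonpos_of_mul_nonneg_right (hxy i) hx)]
      ring
    · rw [Real.sign_of_pos hx, abs_of_nonneg (nonneg_of_mul_nonneg_right (hxy i) hx)]
      ring
  rw [hdot]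
  by_cases hy : y = 0
  · simp [hy]
  obtain ⟨i, hi⟩ := Function.ne_iff.1 hy
  have hq : qNorm 1 (dualVec 1 x) = 1 := by
    rw [qNorm, if_pos rfl]
    simp only [hdual]
    have : Nonempty (Fin d) := ⟨i⟩
    have hle : ∀ j, |Real.sign (x j)| ≤ 1 := fun j => by
      rcases Real.sign_apply_eq (x j) with h | h | h <;> simp [h]
    refine le_antisymm (ciSup_le hle) ?_
    rw [← abs_sign_of_ne_zero (hsupp i hi)]
    exact le_ciSup (f := fun j => |Real.sign (x j)|)
      ⟨1, Set.forall_mem_range.2 hle⟩ i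
  rw [hq, one_mul]

/-- Under the absence of strict `ε`-arbitrage there is `H̄_t ∈ E_{ε,t}` with
`|H̄_t|_p ∈ {0,1}` a.s., `H̄_t* ∈ F_{ε,t}`, of maximal support (componentwise when `p = 1`);
for `p > 1`, `E_{ε,t}` consists exactly of the nonnegative `ℱ_{t-1}`-measurable multiples of
`H̄_t` (up to a.s. equality) and `F_{ε,t}^⊥` has the stated explicit description. -/
theorem exists_Hbar
    {Ω : Type*} [mΩ : MeasurableSpace Ω] {d T : ℕ}
    (P : Measure Ω) [IsProbabilityMeasure P] (ℱ : Filtration ℕ mΩ)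
    (S : ℕ → Ω → Fin d → ℝ) (hS : Adapted ℱ S)
    (hd : 1 ≤ d) (hT : 1 ≤ T) (p ε : ℝ) (hp : 1 ≤ p) (hε : 0 < ε)
    (hNSA : ¬ ∃ H, IsStrictArb P ℱ S T p ε H)
    (t : ℕ) (ht1 : 1 ≤ t) (htT : t ≤ T) :
    ∃ Hb ∈ Eset P ℱ S p ε t,
      (∀ᵐ ω ∂P, pNorm p (Hb ω) = 0 ∨ pNorm p (Hb ω) = 1) ∧
      (fun ω => dualVec p (Hb ω)) ∈ Fset P ℱ S p ε t ∧
      (1 < p → P {ω | Hb ω ≠ 0} = ⨆ h ∈ Eset P ℱ S p ε t, P {ω | h ω ≠ 0}) ∧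
      (p = 1 → ∀ i, P {ω | Hb ω i ≠ 0} = ⨆ h ∈ Eset P ℱ S p ε t, P {ω | h ω i ≠ 0}) ∧
      (1 < p →
        (∀ h ∈ Eset P ℱ S p ε t, ∃ a : Ω → ℝ, StronglyMeasurable[ℱ (t - 1)] a ∧
          (∀ᵐ ω ∂P, 0 ≤ a ω) ∧ h =ᵐ[P] fun ω => a ω • Hb ω) ∧
        (∀ a : Ω → ℝ, StronglyMeasurable[ℱ (t - 1)] a → (∀ᵐ ω ∂P, 0 ≤ a ω) →
          (fun ω => a ω • Hb ω) ∈ Eset P ℱ S p ε t) ∧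
        ({h : Ω → Fin d → ℝ | StronglyMeasurable[ℱ (t - 1)] h ∧
            ∀ X ∈ Fset P ℱ S p ε t, ∀ᵐ ω ∂P, dot (X ω) (h ω) = 0} =
          {h : Ω → Fin d → ℝ | StronglyMeasurable[ℱ (t - 1)] h ∧
            (∀ᵐ ω ∂P, dot (h ω) (dualVec p (Hb ω)) = 0) ∧
            ∀ᵐ ω ∂P, Hb ω = 0 → h ω = 0})) := by
  obtain ⟨Hb, hHb, hnorm, hmax⟩ :=
    exists_mem_Eset_maximal (P := P) (ℱ := ℱ) (S := S) hp hε hNSA ht1 htT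
  have hmax0 : ∀ h ∈ Eset P ℱ S p ε t, ∀ᵐ ω ∂P, h ω ≠ 0 → Hb ω ≠ 0 := by
    intro h hh
    filter_upwards [hmax h hh] with ω hω h0 hb
    obtain ⟨i, hi⟩ := Function.ne_iff.1 h0
    exact hω i hi (congrFun hb i)
  have hmul : 1 < p → ∀ h ∈ Eset P ℱ S p ε t, ∀ᵐ ω ∂P, h ω = pNorm p (h ω) • Hb ω := by
    intro hp1 h hh
    filter_upwards [hmax0 h hh, pNorm_add_eq_of_mem_Eset hp hε hNSA ht1 htT hHb hh]
      with ω hω hadd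
    by_cases h0 : h ω = 0
    · simp [h0, (pNorm_eq_zero hp).2]
    · rw [pNorm_smul_eq_of_pNorm_add_eq hp1 hadd, hnorm ω (hω h0), one_smul]
  have hq0 : 1 < p → qNorm p (0 : Fin d → ℝ) = 0 := by
    intro hp1
    have hpq := Real.HolderConjugate.conjExponent hp1
    rw [qNorm_of_holderConjugate hpq, pNorm_eq_zero hpq.symm.lt.le]
  have hdualF : (fun ω => dualVec p (Hb ω)) ∈ Fset P ℱ S p ε t := by
    refine ⟨stronglyMeasurable_dualVec p hHb.1, fun h hh => ?_⟩
    rcases hp.eq_or_lt with rfl | hp1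
    · filter_upwards [hmax h hh, pNorm_add_eq_of_mem_Eset hp hε hNSA ht1 htT hHb hh]
        with ω hω hadd
      exact dot_dualVec_one (mul_nonneg_of_pNorm_add_eq hp hadd) hω
    · filter_upwards [hmul hp1 h hh] with ω hω
      by_cases hb : Hb ω = 0
      · have h0 : h ω = 0 := by rw [hω, hb, smul_zero]
        simp [h0, (pNorm_eq_zero hp).2]
      · have hpq := Real.HolderConjugate.conjExponent hp1
        rw [qNorm_of_holderConjugate hpq, pNorm_dualVec_of_pNorm_eq_one hpq (hnorm ω hb), one_mul]
        conv_lhs => rw [hω]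
        rw [dot_comm, dot_smul_left, dot_comm, dot_dualVec_of_pNorm_eq_one hp1 (hnorm ω hb),
          mul_one]
  refine ⟨Hb, hHb, Eventually.of_forall fun ω => ?_, hdualF,
    fun _ => measure_eq_iSup_of_maximal hHb (· ≠ 0) hmax0,
    fun _ i => measure_eq_iSup_of_maximal hHb (fun x => x i ≠ 0) fun h hh => ?_,
    fun hp1 => ⟨fun h hh => ⟨fun ω => pNorm p (h ω), stronglyMeasurable_pNorm p hh.1,
      Eventually.of_forall fun ω => pNorm_nonneg p _, hmul hp1 h hh⟩,
      fun a ha ha0 => smul_mem_Eset hp hHb ha ha0, ?_⟩⟩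
  · by_cases hb : Hb ω = 0
    · exact Or.inl ((pNorm_eq_zero hp).2 hb)
    · exact Or.inr (hnorm ω hb)
  · filter_upwards [hmax h hh] with ω hω using hω i
  ext h
  refine and_congr_right fun hh => ⟨fun hX => ⟨?_, ?_⟩, fun ⟨hperp, hsupp⟩ X hX => ?_⟩
  · filter_upwards [hX _ hdualF] with ω hω
    rwa [dot_comm]
  · have hmeas : MeasurableSet[ℱ (t - 1)] {ω | Hb ω = 0} :=
      hHb.1.measurable (measurableSet_singleton 0)
    have hF : {ω | Hb ω = 0}.indicator h ∈ Fset P ℱ S p ε t := by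
      refine ⟨hh.indicator hmeas, fun k hk => ?_⟩
      filter_upwards [hmul hp1 k hk] with ω hω
      by_cases hb : Hb ω = 0
      · have h0 : k ω = 0 := by rw [hω, hb, smul_zero]
        simp [h0, (pNorm_eq_zero hp).2]
      · simp [hb, hq0 hp1]
    filter_upwards [hX _ hF] with ω hω hb
    rw [Set.indicator_of_mem (by exact hb)] at hω
    exact dot_self_eq_zero hω
  · filter_upwards [hperp, hsupp, hX.2 Hb hHb] with ω hω hs hXb
    by_cases hb : Hb ω = 0
    · rw [hs hb, dot_zero_right]
    have hpq := Real.HolderConjugate.conjExponent hp1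
    rw [hnorm ω hb, mul_one, qNorm_of_holderConjugate hpq] at hXb
    by_cases hX0 : X ω = 0
    · rw [hX0, dot_zero_left]
    have hn := (pNorm_eq_zero hpq.symm.lt.le).not.2 hX0
    have hdual : (pNorm p.conjExponent (X ω))⁻¹ • X ω = dualVec p (Hb ω) :=
      eq_dualVec_of_dot_eq_one hpq (hnorm ω hb) (pNorm_inv_smul_self hpq.symm.lt.le hX0) <| by
        rw [dot_comm, dot_smul_left, hXb, inv_mul_cancel₀ hn]
    rw [← hdual, dot_comm, dot_smul_left] at hω
    exact (mul_eq_zero.1 hω).resolve_left (inv_ne_zero hn)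

end QFTAP
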